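/- Let X be a one-sided subshift of finite type, μ a σ-invariant Borel probability measure, f : X → (0,∞) continuous, and let g̲, ḡ : X → (0,∞) be continuous with g̲ ≤ f ≤ ḡ pointwise, ∫ g̲ dμ ≥ (1/2)∫ f dμ and ∫ ḡ dμ ≤ 2∫ f dμ. Then for every Borel set I ⊆ X and t > 0: K(μ^{g̲}, t, I×{0}, Λ_{g̲}) + log(1/2) ≤ K(μ^f, t, I×{0}, Λ_f) ≤ K(μ^{ḡ}, t, I×{0}, Λ_{ḡ}) + log 2. -/

import Mathlib

open Filter Set MeasureTheory

noncomputable section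

/-- The one-sided full shift map on sequences over the alphabet `Fin a`. -/
def shiftMap (a : ℕ) : (ℕ → Fin a) → (ℕ → Fin a) := fun x n => x (n + 1)

/-- The one-sided subshift of finite type determined by the 0-1 transition matrix `A`. -/
def SFT {a : ℕ} (A : Matrix (Fin a) (Fin a) ℕ) : Set (ℕ → Fin a) :=
  {x | ∀ n, A (x n) (x (n + 1)) = 1}

/-- The cylinder of length `n` around `x`. -/
def cyl {a : ℕ} (x : ℕ → Fin a) (n : ℕ) : Set (ℕ → Fin a) := {y | ∀ i < n, y i = x i}

/-- The Birkhoff sum `S_m f(x) = Σ_{k<m} f(σ^k x)`. -/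
def birkhoff {a : ℕ} (f : (ℕ → Fin a) → ℝ) (m : ℕ) (x : ℕ → Fin a) : ℝ :=
  ∑ k ∈ Finset.range m, f ((shiftMap a)^[k] x)

/-- The suspension space `Λ_f = {(x,t) : x ∈ X, 0 ≤ t < f(x)}`. -/
def susp {a : ℕ} (X : Set (ℕ → Fin a)) (f : (ℕ → Fin a) → ℝ) : Set ((ℕ → Fin a) × ℝ) :=
  {p | p.1 ∈ X ∧ 0 ≤ p.2 ∧ p.2 < f p.1}

open Classical in
/-- The special semi-flow `Φ_f^t` over the shift with roof function `f`:
`Φ_f^t(x,s) = (σ^m x, s + t − S_m f(x))` where `S_m f(x) ≤ s+t < S_{m+1} f(x)`. -/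
def susFlow {a : ℕ} (f : (ℕ → Fin a) → ℝ) (t : ℝ) (p : (ℕ → Fin a) × ℝ) :
    (ℕ → Fin a) × ℝ :=
  if h : ∃ m : ℕ, birkhoff f m p.1 ≤ p.2 + t ∧ p.2 + t < birkhoff f (m + 1) p.1 then
    ((shiftMap a)^[h.choose] p.1, p.2 + t - birkhoff f h.choose p.1)
  else p

/-- The normalized suspension measure `μ^f = (μ × Leb)/∫ f dμ` on `Λ_f`. -/
def suspMeasure {a : ℕ} (μ : Measure (ℕ → Fin a)) [SFinite μ] (X : Set (ℕ → Fin a))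
    (f : (ℕ → Fin a) → ℝ) : Measure ((ℕ → Fin a) × ℝ) :=
  (ENNReal.ofReal (∫ x, f x ∂μ))⁻¹ • ((μ.prod volume).restrict (susp X f))

/-- `K(ν,t,H,Λ_f) = log ν{p ∈ Λ_f : Φ_f^s p ∉ H for all s ∈ [0,t]}`, valued in `EReal`
(so that `log 0 = ⊥`). -/
def Kc {a : ℕ} (ν : Measure ((ℕ → Fin a) × ℝ)) (t : ℝ) (H : Set ((ℕ → Fin a) × ℝ))
    (X : Set (ℕ → Fin a)) (f : (ℕ → Fin a) → ℝ) : EReal :=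
  ENNReal.log (ν {p | p ∈ susp X f ∧ ∀ s ∈ Set.Icc (0 : ℝ) t, susFlow f s p ∉ H})


lemma measurableSet_SFT {a : ℕ} (A : Matrix (Fin a) (Fin a) ℕ) : MeasurableSet (SFT A) := by
  rw [SFT, ofPred_forall]
  refine MeasurableSet.iInter fun n => ?_
  have h : Measurable fun x : ℕ → Fin a => (x n, x (n + 1)) := by fun_prop
  exact h (MeasurableSet.of_discrete (s := {p : Fin a × Fin a | A p.1 p.2 = 1}))

lemma shiftMap_iterate_mem_SFT {a : ℕ} {A : Matrix (Fin a) (Fin a) ℕ} {x : ℕ → Fin a}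
    (hx : x ∈ SFT A) (k : ℕ) : (shiftMap a)^[k] x ∈ SFT A := by
  induction k with
  | zero => exact hx
  | succ k ih =>
    rw [Function.iterate_succ_apply']
    exact fun n => ih (n + 1)

lemma continuousOn_of_cyl {a : ℕ} {X : Set (ℕ → Fin a)} {f : (ℕ → Fin a) → ℝ}
    (hf : ∀ x ∈ X, ∀ ε : ℝ, 0 < ε → ∃ n : ℕ, ∀ y ∈ X ∩ cyl x n, |f x - f y| < ε) :
    ContinuousOn f X := by
  intro x hx
  rw [ContinuousWithinAt, Metric.tendsto_nhds]
  intro ε hε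
  obtain ⟨n, hn⟩ := hf x hx ε hε
  have hopen : IsOpen (cyl x n) := PiNat.isOpen_cylinder (fun _ => Fin a) x n
  have hcyl : cyl x n ∈ nhds x := hopen.mem_nhds fun _ _ => rfl
  filter_upwards [mem_nhdsWithin_of_mem_nhds hcyl, self_mem_nhdsWithin] with y hy hyX
  rw [dist_comm, Real.dist_eq]
  exact hn y ⟨hyX, hy⟩

lemma birkhoff_strictMono {a : ℕ} {f : (ℕ → Fin a) → ℝ} {x : ℕ → Fin a}
    (hf : ∀ k, 0 < f ((shiftMap a)^[k] x)) : StrictMono fun m => birkhoff f m x :=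
  strictMono_nat_of_lt_succ fun m => by
    simp only [birkhoff, Finset.sum_range_succ]
    linarith [hf m]

lemma susFlow_eq_of_add_eq_birkhoff {a : ℕ} {f : (ℕ → Fin a) → ℝ} {x : ℕ → Fin a} {s t : ℝ}
    (hf : ∀ k, 0 < f ((shiftMap a)^[k] x)) {m : ℕ} (h : s + t = birkhoff f m x) :
    susFlow f t (x, s) = ((shiftMap a)^[m] x, 0) := by
  have hmono := birkhoff_strictMono hf
  have hex : ∃ m : ℕ, birkhoff f m x ≤ s + t ∧ s + t < birkhoff f (m + 1) x :=
    ⟨m, h.ge, h.trans_lt (hmono m.lt_succ_self)⟩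
  have hm : hex.choose = m := by
    obtain ⟨h1, h2⟩ := hex.choose_spec
    exact le_antisymm (hmono.le_iff_le.1 (h1.trans_eq h))
      (Nat.lt_succ_iff.1 (hmono.lt_iff_lt.1 (h.symm.trans_lt h2)))
  rw [susFlow, dif_pos hex, hm]
  simp [h]

lemma exists_of_susFlow_mem {a : ℕ} {f : (ℕ → Fin a) → ℝ} {x : ℕ → Fin a} {s t : ℝ}
    {I : Set (ℕ → Fin a)} (h : susFlow f t (x, s) ∈ I ×ˢ ({0} : Set ℝ)) :
    (∃ m : ℕ, (shiftMap a)^[m] x ∈ I ∧ s + t = birkhoff f m x) ∨ (x ∈ I ∧ s = 0) := by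
  by_cases hex : ∃ m : ℕ, birkhoff f m x ≤ s + t ∧ s + t < birkhoff f (m + 1) x
  · rw [susFlow, dif_pos hex] at h
    exact Or.inl ⟨hex.choose, h.1, sub_eq_zero.1 h.2⟩
  · rw [susFlow, dif_neg hex] at h
    exact Or.inr h

/-- Shifting each fibre so that the roofs match sends points that avoid `I × {0}` under the
semi-flow with the lower roof to points that avoid it under the one with the higher roof. -/
lemma nonescape_mem_of_le {a : ℕ} {A : Matrix (Fin a) (Fin a) ℕ} {f g : (ℕ → Fin a) → ℝ}
    (hf : ∀ x ∈ SFT A, 0 < f x) (hfg : ∀ x ∈ SFT A, f x ≤ g x) {I : Set (ℕ → Fin a)} {t : ℝ}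
    (ht : 0 ≤ t) {x : ℕ → Fin a} {s : ℝ} (hxs : (x, s) ∈ susp (SFT A) f)
    (h : ∀ u ∈ Set.Icc (0 : ℝ) t, susFlow f u (x, s) ∉ I ×ˢ ({0} : Set ℝ)) :
    (x, s + (g x - f x)) ∈ susp (SFT A) g ∧
      ∀ u ∈ Set.Icc (0 : ℝ) t, susFlow g u (x, s + (g x - f x)) ∉ I ×ˢ ({0} : Set ℝ) := by
  obtain ⟨hx, hs0, hsf⟩ := hxs
  dsimp only at hx hs0 hsf
  have hle := hfg x hx
  have horbit := shiftMap_iterate_mem_SFT hx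
  have hfk : ∀ k, 0 < f ((shiftMap a)^[k] x) := fun k => hf _ (horbit k)
  have hbase : s = 0 → x ∉ I := by
    intro hs hxI
    refine h 0 ⟨le_rfl, ht⟩ ?_
    rw [susFlow_eq_of_add_eq_birkhoff hfk (m := 0) (by simp [hs, birkhoff])]
    exact ⟨hxI, rfl⟩
  refine ⟨⟨hx, by dsimp only; linarith, by dsimp only; linarith⟩, fun u hu hmem => ?_⟩
  rcases exists_of_susFlow_mem hmem with ⟨m, hmI, hm⟩ | ⟨hxI, hs⟩
  · cases m with
    | zero =>
      simp only [birkhoff, Finset.range_zero, Finset.sum_empty] at hm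
      exact hbase (by linarith [hu.1]) hmI
    | succ m =>
      have hsum : ∑ k ∈ Finset.range m, f ((shiftMap a)^[k + 1] x) ≤
          ∑ k ∈ Finset.range m, g ((shiftMap a)^[k + 1] x) :=
        Finset.sum_le_sum fun k _ => hfg _ (horbit _)
      have hnonneg : 0 ≤ ∑ k ∈ Finset.range m, f ((shiftMap a)^[k + 1] x) :=
        Finset.sum_nonneg fun k _ => (hfk _).le
      have hBf : birkhoff f (m + 1) x =
          ∑ k ∈ Finset.range m, f ((shiftMap a)^[k + 1] x) + f x := Finset.sum_range_succ' _ _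
      have hBg : birkhoff g (m + 1) x =
          ∑ k ∈ Finset.range m, g ((shiftMap a)^[k + 1] x) + g x := Finset.sum_range_succ' _ _
      refine h (birkhoff f (m + 1) x - s) ⟨by linarith, by linarith [hu.2]⟩ ?_
      rw [susFlow_eq_of_add_eq_birkhoff hfk (m := m + 1) (by ring)]
      exact ⟨hmI, rfl⟩
  · exact hbase (by linarith) hxI

lemma measurePreserving_fibre_add {α : Type*} [MeasurableSpace α] (μ : Measure α) [SFinite μ]
    {h : α → ℝ} (hh : Measurable h) :
    MeasurePreserving (fun p : α × ℝ => (p.1, p.2 + h p.1))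
      (μ.prod volume) (μ.prod volume) :=
  (MeasurePreserving.id μ).skew_product (g := fun x s => s + h x)
    (by unfold Function.uncurry; fun_prop)
    (ae_of_all _ fun x => map_add_right_eq_self volume (h x))

lemma Kc_le_Kc_add_log_two {a : ℕ} {A : Matrix (Fin a) (Fin a) ℕ} (μ : Measure (ℕ → Fin a))
    [SFinite μ] {f g : (ℕ → Fin a) → ℝ} (hf : ∀ x ∈ SFT A, 0 < f x)
    (hfcont : ContinuousOn f (SFT A)) (hgcont : ContinuousOn g (SFT A))
    (hfg : ∀ x ∈ SFT A, f x ≤ g x) (hint : ∫ x, g x ∂μ ≤ 2 * ∫ x, f x ∂μ)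
    (I : Set (ℕ → Fin a)) {t : ℝ} (ht : 0 ≤ t) :
    Kc (suspMeasure μ (SFT A) f) t (I ×ˢ ({0} : Set ℝ)) (SFT A) f ≤
      Kc (suspMeasure μ (SFT A) g) t (I ×ˢ ({0} : Set ℝ)) (SFT A) g +
        ((Real.log 2 : ℝ) : EReal) := by
  classical
  rw [← ENNReal.log_ofReal_of_pos two_pos, Kc, Kc, ← ENNReal.log_mul_add]
  refine ENNReal.log_monotone ?_
  simp only [suspMeasure, Measure.smul_apply, smul_eq_mul]
  rw [Measure.restrict_eq_self _ fun p hp => hp.1, Measure.restrict_eq_self _ fun p hp => hp.1]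
  have hmeas : Measurable ((SFT A).piecewise (fun x => g x - f x) 0) :=
    (hgcont.sub hfcont).measurable_piecewise continuousOn_const (measurableSet_SFT A)
  have hT := measurePreserving_fibre_add μ hmeas
  have hset : (μ.prod volume) {p | p ∈ susp (SFT A) f ∧
        ∀ s ∈ Set.Icc (0 : ℝ) t, susFlow f s p ∉ I ×ˢ ({0} : Set ℝ)} ≤
      (μ.prod volume) {p | p ∈ susp (SFT A) g ∧
        ∀ s ∈ Set.Icc (0 : ℝ) t, susFlow g s p ∉ I ×ˢ ({0} : Set ℝ)} := by
    refine le_trans (measure_mono ?_)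
      ((Measure.le_map_apply hT.aemeasurable _).trans_eq (by rw [hT.map_eq]))
    rintro ⟨x, s⟩ ⟨hxs, hav⟩
    have key := nonescape_mem_of_le hf hfg ht hxs hav
    rw [mem_preimage, piecewise_eq_of_mem _ _ _ hxs.1]
    exact key
  have hinv : (ENNReal.ofReal (∫ x, f x ∂μ))⁻¹ ≤
      ENNReal.ofReal 2 * (ENNReal.ofReal (∫ x, g x ∂μ))⁻¹ := by
    have h2 : ENNReal.ofReal (∫ x, g x ∂μ) ≤ ENNReal.ofReal 2 * ENNReal.ofReal (∫ x, f x ∂μ) := by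
      rw [← ENNReal.ofReal_mul two_pos.le]
      exact ENNReal.ofReal_le_ofReal hint
    calc (ENNReal.ofReal (∫ x, f x ∂μ))⁻¹
        = ENNReal.ofReal 2 * (ENNReal.ofReal 2 * ENNReal.ofReal (∫ x, f x ∂μ))⁻¹ := by
          rw [ENNReal.mul_inv (by simp) (by simp), ← mul_assoc,
            ENNReal.mul_inv_cancel (by simp) (by simp), one_mul]
      _ ≤ _ := by gcongr
  calc _ ≤ _ := mul_le_mul' hinv hset
    _ = _ := by ring

/-- Sandwiching the non-escape quantity of `f` between those of a lower
approximation `g̲` and an upper approximation `ḡ`, up to additive constants `log(1/2)`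
and `log 2`. -/
theorem K_sandwich
    (a : ℕ) (ha : 2 ≤ a) (A : Matrix (Fin a) (Fin a) ℕ)
    (hA01 : ∀ i j, A i j = 0 ∨ A i j = 1)
    (hAper : ∃ d : ℕ, 0 < d ∧ ∀ i j, 0 < (A ^ d) i j)
    (μ : Measure (ℕ → Fin a)) [IsProbabilityMeasure μ]
    (hsupp : μ (SFT A) = 1)
    (hinv : ∀ B : Set (ℕ → Fin a), MeasurableSet B → μ (shiftMap a ⁻¹' B) = μ B)
    (f gl gu : (ℕ → Fin a) → ℝ)
    (hfpos : ∀ x ∈ SFT A, 0 < f x)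
    (hglpos : ∀ x ∈ SFT A, 0 < gl x) (hgupos : ∀ x ∈ SFT A, 0 < gu x)
    (hfcont : ∀ x ∈ SFT A, ∀ ε : ℝ, 0 < ε → ∃ n : ℕ, ∀ y ∈ SFT A ∩ cyl x n, |f x - f y| < ε)
    (hglcont : ∀ x ∈ SFT A, ∀ ε : ℝ, 0 < ε → ∃ n : ℕ, ∀ y ∈ SFT A ∩ cyl x n, |gl x - gl y| < ε)
    (hgucont : ∀ x ∈ SFT A, ∀ ε : ℝ, 0 < ε → ∃ n : ℕ, ∀ y ∈ SFT A ∩ cyl x n, |gu x - gu y| < ε)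
    (hsandwich : ∀ x ∈ SFT A, gl x ≤ f x ∧ f x ≤ gu x)
    (hIntl : (1 / 2 : ℝ) * ∫ x, f x ∂μ ≤ ∫ x, gl x ∂μ)
    (hIntu : ∫ x, gu x ∂μ ≤ 2 * ∫ x, f x ∂μ)
    (I : Set (ℕ → Fin a)) (hI : MeasurableSet I) (hIX : I ⊆ SFT A)
    (t : ℝ) (ht : 0 < t) :
    Kc (suspMeasure μ (SFT A) gl) t (I ×ˢ ({0} : Set ℝ)) (SFT A) gl +
        ((Real.log (1 / 2) : ℝ) : EReal) ≤
      Kc (suspMeasure μ (SFT A) f) t (I ×ˢ ({0} : Set ℝ)) (SFT A) f ∧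
    Kc (suspMeasure μ (SFT A) f) t (I ×ˢ ({0} : Set ℝ)) (SFT A) f ≤
      Kc (suspMeasure μ (SFT A) gu) t (I ×ˢ ({0} : Set ℝ)) (SFT A) gu +
        ((Real.log 2 : ℝ) : EReal) := by
  have hf := continuousOn_of_cyl hfcont
  refine ⟨?_, Kc_le_Kc_add_log_two μ hfpos hf (continuousOn_of_cyl hgucont)
    (fun x hx => (hsandwich x hx).2) hIntu I ht.le⟩
  have h := Kc_le_Kc_add_log_two μ hglpos (continuousOn_of_cyl hglcont) hf
    (fun x hx => (hsandwich x hx).1) (by linarith) I ht.le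
  rw [one_div, Real.log_inv, EReal.coe_neg, ← sub_eq_add_neg]
  exact EReal.sub_le_of_le_add h

end
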